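/- Let X be a countable subshift of finite type (SFT) over a finite alphabet A and let (c_i)_{i∈ℕ} be a sequence in X with c_{i+1} ≺ c_i for every i ∈ ℕ. Then there exists a configuration c ∈ X with c ⪯ c_i for all i ∈ ℕ such that c is neither at level 0 nor at level 1 in X. In other words, in a countable SFT there is no infinite strictly decreasing ⪯-chain all of whose lower bounds are at level 0 or level 1. -/

import Mathlib

namespace CountableSubshift

/-- A configuration over alphabet `A` on the plane `ℤ × ℤ`. -/
abbrev Config (A : Type*) := ℤ × ℤ → A

variable {A : Type*}

/-- The shift by a vector `v`. -/
def shift (v : ℤ × ℤ) (x : Config A) : Config A := fun u => x (u + v)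

/-- The shift-orbit of a configuration. -/
def orbit (x : Config A) : Set (Config A) := Set.range fun v => shift v x

variable [TopologicalSpace A]

/-- `Preceq x y` iff `x` belongs to the closure of the shift-orbit of `y`. -/
def Preceq (x y : Config A) : Prop := x ∈ closure (orbit y)

/-- Strict version of `Preceq`. -/
def Prec (x y : Config A) : Prop := Preceq x y ∧ ¬ Preceq y x

/-- `x ≈ y` : mutual `Preceq`. -/
def OrbEquiv (x y : Config A) : Prop := Preceq x y ∧ Preceq y x

/-- A subshift: nonempty, closed and shift-invariant set of configurations. -/
def IsSubshift (X : Set (Config A)) : Prop :=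
  X.Nonempty ∧ IsClosed X ∧ ∀ v : ℤ × ℤ, shift v '' X = X

/-- A configuration is periodic if it has two linearly independent vectors of periodicity. -/
def Periodic (x : Config A) : Prop :=
  ∃ v w : ℤ × ℤ, shift v x = x ∧ shift w x = x ∧ LinearIndependent ℤ ![v, w]

/-- `x` is at level 0 in `X`: it is `Preceq`-minimal in `X`. -/
def Level0 (X : Set (Config A)) (x : Config A) : Prop :=
  x ∈ X ∧ ∀ y ∈ X, Preceq y x → Preceq x y

/-- `x` is at level 1 in `X`. -/
def Level1 (X : Set (Config A)) (x : Config A) : Prop :=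
  x ∈ X ∧ ¬ Level0 X x ∧ ∀ y ∈ X, Prec y x → Level0 X y

/-- `x` is at level 2 in `X`. -/
def Level2 (X : Set (Config A)) (x : Config A) : Prop :=
  x ∈ X ∧ ¬ Level0 X x ∧ ¬ Level1 X x ∧ ∀ y ∈ X, Prec y x → Level0 X y ∨ Level1 X y

/-- The pattern `p` with (finite) domain `D` appears in `x` at position `u`. -/
def AppearsAt (D : Finset (ℤ × ℤ)) (p : ℤ × ℤ → A) (x : Config A) (u : ℤ × ℤ) : Prop :=
  ∀ d ∈ D, x (u + d) = p d

/-- A subshift of finite type: the nonempty set of configurations avoiding a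
finite family of forbidden patterns. -/
def IsSFT (X : Set (Config A)) : Prop :=
  X.Nonempty ∧ ∃ (n : ℕ) (D : Fin n → Finset (ℤ × ℤ)) (p : Fin n → ℤ × ℤ → A),
    X = {x : Config A | ∀ (i : Fin n) (u : ℤ × ℤ), ¬ AppearsAt (D i) (p i) x u}

/-- Every pattern appearing in `c` appears at infinitely many positions. -/
def AllPatternsInfinite (c : Config A) : Prop :=
  ∀ (D : Finset (ℤ × ℤ)) (u : ℤ × ℤ),
    {u' : ℤ × ℤ | ∀ d ∈ D, c (u' + d) = c (u + d)}.Infinite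

/-- The standard dot product on `ℤ × ℤ`. -/
def dot (u w : ℤ × ℤ) : ℤ := u.1 * w.1 + u.2 * w.2

section Helpers

open Filter Topology

variable {α : Type*}

/-- `v` is a period of `x`. -/
def Per (v : ℤ × ℤ) (x : Config α) : Prop := ∀ u, x (u + v) = x u

theorem Per.sub {v w : ℤ × ℤ} {x : Config α} (hv : Per v x) (hw : Per w x) : Per (v - w) x := by
  intro u
  rw [← hw (u + (v - w)), ← hv u]
  congr 1
  abel

theorem Per.zero (x : Config α) : Per 0 x := fun u => by rw [add_zero]

theorem Per.neg {v : ℤ × ℤ} {x : Config α} (hv : Per v x) : Per (-v) x := by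
  simpa using (Per.zero x).sub hv

theorem Per.add {v w : ℤ × ℤ} {x : Config α} (hv : Per v x) (hw : Per w x) : Per (v + w) x := by
  simpa using hv.sub hw.neg

theorem Per.nsmul {v : ℤ × ℤ} {x : Config α} (hv : Per v x) (n : ℕ) : Per (n • v) x := by
  induction n with
  | zero => simpa using Per.zero x
  | succ n ih => rw [succ_nsmul]; exact ih.add hv

theorem Per.zsmul {v : ℤ × ℤ} {x : Config α} (hv : Per v x) (n : ℤ) : Per (n • v) x := by
  obtain ⟨m, rfl | rfl⟩ := n.eq_nat_or_neg
  · simpa using hv.nsmul m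
  · simpa using (hv.nsmul m).neg

theorem shift_shift (v w : ℤ × ℤ) (x : Config α) : shift v (shift w x) = shift (v + w) x := by
  funext u
  simp [shift, add_assoc]

theorem shift_eq_self_iff {v : ℤ × ℤ} {x : Config α} : shift v x = x ↔ Per v x :=
  funext_iff

/-- Every vector has a positive multiple that is a period of `x`. -/
def FullPer (x : Config α) : Prop := ∀ v : ℤ × ℤ, ∃ k : ℤ, 0 < k ∧ Per (k • v) x

/-- `w` is a cluster point of the sequence `x`. -/
def IsClus (x : ℕ → Config α) (w : Config α) : Prop :=
  ∀ E : Finset (ℤ × ℤ), ∃ᶠ n in atTop, ∀ e ∈ E, x n e = w e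

theorem IsClus.exists_ge {x : ℕ → Config α} {w : Config α} (h : IsClus x w)
    (E : Finset (ℤ × ℤ)) (m : ℕ) : ∃ n ≥ m, ∀ e ∈ E, x n e = w e :=
  (frequently_atTop.1 (h E)) m

/-- `X` is shift-invariant and membership in `X` is decided by the patterns of shape `D`. -/
structure IsLocal (X : Set (Config α)) (D : Finset (ℤ × ℤ)) : Prop where
  inv : ∀ x ∈ X, ∀ v, shift v x ∈ X
  loc : ∀ x, (∀ u, ∃ z ∈ X, ∀ d ∈ D, x (u + d) = z (u + d)) → x ∈ X

theorem IsSFT.exists_isLocal {X : Set (Config α)} (hX : IsSFT X) : ∃ D, IsLocal X D := by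
  obtain ⟨-, n, D, p, rfl⟩ := hX
  refine ⟨Finset.univ.biUnion D, ?_, ?_⟩
  · intro x hx v i u h
    refine hx i (u + v) fun d hd => ?_
    rw [← h d hd]
    simp only [shift]
    congr 1
    abel
  · intro x hx i u h
    obtain ⟨z, hz, hxz⟩ := hx u
    refine hz i u fun d hd => ?_
    rw [← h d hd, hxz d (Finset.mem_biUnion.2 ⟨i, Finset.mem_univ _, hd⟩)]

theorem IsLocal.clus_mem {X : Set (Config α)} {D : Finset (ℤ × ℤ)} (hX : IsLocal X D)
    {x : ℕ → Config α} {w : Config α} (hx : ∀ n, x n ∈ X) (hw : IsClus x w) : w ∈ X := by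
  classical
  refine hX.loc w fun u => ?_
  obtain ⟨n, -, hn⟩ := hw.exists_ge (D.image (u + ·)) 0
  exact ⟨x n, hx n, fun d hd => (hn _ (Finset.mem_image_of_mem _ hd)).symm⟩

/-- If infinitely many translates `n • v + a` are periods, so is a positive multiple of `v`. -/
theorem exists_per_of_frequently {x : Config α} {v a : ℤ × ℤ}
    (h : ∃ᶠ n : ℕ in atTop, Per ((n : ℤ) • v + a) x) : ∃ k : ℤ, 0 < k ∧ Per (k • v) x := by
  obtain ⟨n, -, hn⟩ := frequently_atTop.1 h 0
  obtain ⟨m, hm, hmx⟩ := frequently_atTop.1 h (n + 1)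
  refine ⟨m - n, by omega, ?_⟩
  convert hmx.sub hn using 1
  module

/-- If every pattern of `y` occurs in `x` at a position of the finite set `S`, then `y` is a
shift of `x`. -/
theorem exists_shift_eq {x y : Config α} (S : Finset (ℤ × ℤ))
    (h : ∀ E : Finset (ℤ × ℤ), ∃ s ∈ S, ∀ e ∈ E, x (e + s) = y e) : ∃ s, y = shift s x := by
  classical
  by_contra! hne
  have : ∀ s, ∃ e, x (e + s) ≠ y e := fun s => by
    by_contra! h'
    exact hne s (funext fun e => (h' e).symm)
  choose e he using this
  obtain ⟨s, hs, hse⟩ := h (S.image e)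
  exact he s (hse _ (Finset.mem_image_of_mem _ hs))

/-- `X` is shift-invariant and membership in `X` is decided by the strips `|h| ≤ r`. -/
structure RowLocal (X : Set (Config α)) (h : ℤ × ℤ →+ ℤ) (r : ℤ) : Prop where
  inv : ∀ x ∈ X, ∀ v, shift v x ∈ X
  loc : ∀ x, (∀ u, ∃ z ∈ X, ∀ d, |h d| ≤ r → x (u + d) = z (u + d)) → x ∈ X

theorem IsLocal.exists_rowLocal {X : Set (Config α)} {D : Finset (ℤ × ℤ)} (hX : IsLocal X D)
    (h : ℤ × ℤ →+ ℤ) : ∃ r : ℕ, RowLocal X h r := by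
  refine ⟨D.sup fun d => (h d).natAbs, hX.inv, fun x hx => hX.loc x fun u => ?_⟩
  obtain ⟨z, hz, hxz⟩ := hx u
  refine ⟨z, hz, fun d hd => hxz d ?_⟩
  have := Finset.le_sup (f := fun d => (h d).natAbs) hd
  rw [Int.abs_eq_natAbs]
  exact_mod_cast this

/-- In a countable set, two configurations that can be freely concatenated coincide. -/
theorem RowLocal.eq_of_paste {X : Set (Config α)} {h : ℤ × ℤ →+ ℤ} {r : ℤ}
    (hX : RowLocal X h r) (hcount : X.Countable) {W : ℤ × ℤ} (hW : 0 < h W) (hr : r ≤ h W)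
    {x y : Config α} (hx : x ∈ X) (hy : y ∈ X) (hxy : ∀ u, |h u| ≤ r → x u = y u)
    (hxW : ∀ u, |h u| ≤ r → x (u + W) = x u) (hyW : ∀ u, |h u| ≤ r → y (u + W) = y u)
    {u : ℤ × ℤ} (hu : 0 ≤ h u) (huW : h u < h W) : x u = y u := by
  classical
  by_contra hne
  let z : Prop → Config α := fun b => if b then x else y
  have hz : ∀ b, z b ∈ X := fun b => by
    simp only [z]; split_ifs <;> assumption
  have hzz : ∀ b b' u, |h u| ≤ r → z b u = z b' u := fun b b' u hu => by
    simp only [z]; split_ifs <;> simp [hxy u hu]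
  have hzW : ∀ b u, |h u| ≤ r → z b (u + W) = z b u := fun b u hu => by
    simp only [z]; split_ifs
    exacts [hxW u hu, hyW u hu]
  let F : Set ℤ → Config α := fun S u => z (h u / h W ∈ S) (u - (h u / h W) • W)
  have hF : ∀ S, F S ∈ X := by
    intro S
    refine hX.loc _ fun u => ?_
    set q := h u / h W with hq
    have hq1 : q * h W ≤ h u := Int.ediv_mul_le _ hW.ne'
    have hq2 : h u < (q + 1) * h W := Int.lt_ediv_add_one_mul_self _ hW
    refine ⟨shift (-(q • W)) (z (q ∈ S)), hX.inv _ (hz _) _, fun d hd => ?_⟩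
    have hd' := abs_le.1 hd
    simp only [F, shift]
    by_cases h1 : h (u + d) < q * h W
    · have e1 : h (u + d) / h W = q - 1 := by
        rw [Int.ediv_eq_iff_of_pos hW]
        rw [map_add] at *
        constructor <;> nlinarith
      have hsm : |h (u + d + -(q • W))| ≤ r := by
        simp only [map_add, map_neg, map_zsmul, smul_eq_mul] at h1 ⊢
        rw [abs_le]
        constructor <;> linarith
      rw [e1, hzz (q ∈ S) (q - 1 ∈ S) _ hsm, ← hzW _ _ hsm]
      congr 1
      module
    · by_cases h2 : h (u + d) < (q + 1) * h W
      · have e1 : h (u + d) / h W = q := by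
          rw [Int.ediv_eq_iff_of_pos hW]
          constructor <;> linarith
        rw [e1, sub_eq_add_neg]
      · have e1 : h (u + d) / h W = q + 1 := by
          rw [Int.ediv_eq_iff_of_pos hW]
          rw [map_add] at *
          constructor <;> nlinarith
        have hsm : |h (u + d - (q + 1) • W)| ≤ r := by
          simp only [map_add, map_sub, map_zsmul, smul_eq_mul] at h2 ⊢
          rw [abs_le]
          constructor <;> linarith
        rw [e1, hzz (q + 1 ∈ S) (q ∈ S) _ hsm, ← hzW _ _ hsm]
        congr 1
        module
  have hinj : Function.Injective fun S => (⟨F S, hF S⟩ : X) := by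
    intro S T hST
    have hST' : F S = F T := congrArg Subtype.val hST
    ext q
    have := congrFun hST' (u + q • W)
    have e1 : h (u + q • W) / h W = q := by
      rw [Int.ediv_eq_iff_of_pos hW]
      simp only [map_add, map_zsmul, smul_eq_mul]
      constructor <;> linarith
    simp only [F, e1, add_sub_cancel_right, z] at this
    by_cases hS : q ∈ S <;> by_cases hT : q ∈ T <;> simp_all
  have := hcount.to_subtype
  have := hinj.countable
  obtain ⟨g, hg⟩ := exists_injective_nat (Set ℤ)
  exact Function.cantor_injective (fun S => (g S : ℤ)) (Nat.cast_injective.comp hg)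

/-- Two loops of rows at the same state commute. -/
theorem RowLocal.eq_of_three_states {X : Set (Config α)} {h : ℤ × ℤ →+ ℤ} {r : ℤ}
    (hX : RowLocal X h r) (hcount : X.Countable) {w : ℤ × ℤ} (hw : h w = 1)
    {c : Config α} (hc : c ∈ X) {m n p : ℤ} (hmn : m < n) (hnp : n < p) (hr : r ≤ p - m)
    (hcmn : ∀ u, |h u| ≤ r → c (u + m • w) = c (u + n • w))
    (hcmp : ∀ u, |h u| ≤ r → c (u + m • w) = c (u + p • w))
    {u : ℤ × ℤ} (hu : 0 ≤ h u) (hup : h u < p - n) : c (u + m • w) = c (u + n • w) := by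
  classical
  let y : Config α := fun u => if h u < p - n then c (u + n • w) else c (u + (m - (p - n)) • w)
  have key : ∀ u, |h u - (p - n)| ≤ r → c (u + n • w) = c (u + (m - (p - n)) • w) := by
    intro u hu
    have := hcmp (u - (p - n) • w) (by rwa [map_sub, map_zsmul, hw, smul_eq_mul, mul_one])
    rw [show u + n • w = u - (p - n) • w + p • w by module, ← this]
    congr 1
    module
  have yl : ∀ u, h u - (p - n) ≤ r → y u = c (u + n • w) := by
    intro u hu
    simp only [y]
    split_ifs with h1
    · rfl
    · rw [key u (abs_le.2 ⟨by linarith [abs_nonneg (h u), show (0 : ℤ) ≤ r by linarith], hu⟩)]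
  have yr : ∀ u, -r ≤ h u - (p - n) → y u = c (u + (m - (p - n)) • w) := by
    intro u hu
    simp only [y]
    split_ifs with h1
    · by_cases hr0 : 0 ≤ r
      · rw [key u (abs_le.2 ⟨hu, by linarith⟩)]
      · linarith
    · rfl
  have hy : y ∈ X := by
    refine hX.loc y fun u => ?_
    by_cases h1 : h u < p - n
    · refine ⟨shift (n • w) c, hX.inv c hc _, fun d hd => yl _ ?_⟩
      rw [map_add]
      linarith [(abs_le.1 hd).2]
    · refine ⟨shift ((m - (p - n)) • w) c, hX.inv c hc _, fun d hd => yr _ ?_⟩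
      rw [map_add]
      linarith [(abs_le.1 hd).1]
  have hW : h ((p - m) • w) = p - m := by rw [map_zsmul, hw, smul_eq_mul, mul_one]
  have := hX.eq_of_paste hcount (W := (p - m) • w) (by linarith) (by linarith)
    (hX.inv c hc (m • w)) hy ?_ ?_ ?_ hu (by linarith)
  · simpa only [y, if_pos hup, shift] using this
  · intro u hu
    rw [yl u (by linarith [(abs_le.1 hu).2])]
    exact hcmn u hu
  · intro u hu
    simp only [shift]
    rw [hcmp u hu]
    congr 1
    module
  · intro u hu
    rw [yl u (by linarith [(abs_le.1 hu).2]), ← hcmn u hu]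
    rw [yr _ (by rw [map_add, hW]; linarith [(abs_le.1 hu).1]), hcmn u hu]
    congr 1
    module

/-- The row index of a point with respect to the direction `v`. -/
def rowHom (v : ℤ × ℤ) : ℤ × ℤ →+ ℤ where
  toFun u := v.1 * u.2 - v.2 * u.1
  map_zero' := by simp
  map_add' a b := by simp only [Prod.fst_add, Prod.snd_add]; ring

/-- `v, w` is a positively oriented basis of the lattice. -/
def Frame (v w : ℤ × ℤ) : Prop := rowHom v w = 1

theorem Frame.neg {v w : ℤ × ℤ} (h : Frame v w) : Frame (-v) (-w) := by
  simp only [Frame, rowHom, AddMonoidHom.coe_mk, ZeroHom.coe_mk, Prod.fst_neg, Prod.snd_neg] at *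
  linarith

theorem rowHom_neg (v u : ℤ × ℤ) : rowHom (-v) u = -rowHom v u := by
  simp only [rowHom, AddMonoidHom.coe_mk, ZeroHom.coe_mk, Prod.fst_neg, Prod.snd_neg]
  ring

theorem Frame.exists_decomp {v w : ℤ × ℤ} (h : Frame v w) (u : ℤ × ℤ) :
    ∃ a : ℤ, u = a • v + rowHom v u • w := by
  refine ⟨u.1 * w.2 - u.2 * w.1, ?_⟩
  simp only [Frame, rowHom, AddMonoidHom.coe_mk, ZeroHom.coe_mk] at *
  ext
  · simp
    linear_combination -u.1 * h
  · simp
    linear_combination -u.2 * h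

theorem Frame.exists_decomp_mod {v w : ℤ × ℤ} (h : Frame v w) {K : ℤ} (hK : 0 < K) (u : ℤ × ℤ) :
    ∃ a b : ℤ, 0 ≤ a ∧ a < K ∧ u = a • v + rowHom v u • w + b • K • v := by
  obtain ⟨a, ha⟩ := h.exists_decomp u
  refine ⟨a % K, a / K, Int.emod_nonneg _ hK.ne', Int.emod_lt_of_pos _ hK, ?_⟩
  conv_lhs => rw [ha]
  rw [smul_smul, add_right_comm, ← add_smul, mul_comm, Int.emod_add_mul_ediv]

theorem exists_frame {p : ℤ × ℤ} (hp : p ≠ 0) :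
    ∃ (v w : ℤ × ℤ) (K : ℤ), 0 < K ∧ Frame v w ∧ p = K • v := by
  have hg : 0 < Int.gcd p.1 p.2 := by
    rw [Nat.pos_iff_ne_zero, Ne, Int.gcd_eq_zero_iff]
    exact fun h => hp (Prod.ext h.1 h.2)
  obtain ⟨a, ha⟩ := Int.gcd_dvd_left p.1 p.2
  obtain ⟨b, hb⟩ := Int.gcd_dvd_right p.1 p.2
  have hbez := Int.gcd_eq_gcd_ab p.1 p.2
  set g : ℤ := (Int.gcd p.1 p.2 : ℤ) with hgdef
  have hg' : 0 < g := Int.natCast_pos.2 hg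
  refine ⟨(a, b), (-Int.gcdB p.1 p.2, Int.gcdA p.1 p.2), g, hg', ?_, Prod.ext ?_ ?_⟩
  · simp only [Frame, rowHom, AddMonoidHom.coe_mk, ZeroHom.coe_mk]
    apply mul_left_cancel₀ hg'.ne'
    generalize Int.gcdA p.1 p.2 = s at *
    generalize Int.gcdB p.1 p.2 = t at *
    rw [mul_one]
    linear_combination (-s) * ha - t * hb - hbez
  · simpa using ha
  · simpa using hb

theorem Frame.fullPer {v w : ℤ × ℤ} (h : Frame v w) {K L : ℤ} (hK : 0 < K) (hL : 0 < L)
    {x : Config α} (hv : Per (K • v) x) (hw : Per (L • w) x) : FullPer x := by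
  intro u
  obtain ⟨a, ha⟩ := h.exists_decomp u
  refine ⟨K * L, mul_pos hK hL, ?_⟩
  convert (hv.zsmul (L * a)).add (hw.zsmul (K * rowHom v u)) using 1
  conv_lhs => rw [ha]
  module

/-- Infinitely many rows of a configuration that is periodic along the rows are in the same
state. -/
theorem Frame.exists_infinite_same_state [Finite α] {v w : ℤ × ℤ} (h : Frame v w) {K : ℤ}
    (hK : 0 < K) {c : Config α} (hc : Per (K • v) c) (r : ℤ) :
    ∃ S : Set ℕ, S.Infinite ∧ ∀ m ∈ S, ∀ n ∈ S, ∀ u, |rowHom v u| ≤ r →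
      c (u + (m : ℤ) • w) = c (u + (n : ℤ) • w) := by
  let s : ℕ → (Set.Icc 0 K × Set.Icc (-r) r → α) :=
    fun m it => c ((it.1 : ℤ) • v + (it.2 : ℤ) • w + (m : ℤ) • w)
  obtain ⟨y, hy⟩ := Finite.exists_infinite_fiber s
  refine ⟨s ⁻¹' {y}, Set.infinite_coe_iff.1 hy, fun m hm n hn u hu => ?_⟩
  obtain ⟨a, b, ha, haK, hab⟩ := h.exists_decomp_mod hK u
  have hmn : s m = s n := hm.trans hn.symm
  have key : ∀ k : ℕ, c (u + (k : ℤ) • w) =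
      s k (⟨a, ha, haK.le⟩, ⟨rowHom v u, abs_le.1 hu⟩) := by
    intro k
    simp only [s]
    rw [← (hc.zsmul b) (a • v + _ + _)]
    congr 1
    conv_lhs => rw [hab]
    abel
  rw [key, key, hmn]

/-- A configuration that is periodic along the rows is eventually periodic across them. -/
theorem IsLocal.exists_eventually_per [Finite α] {X : Set (Config α)} {D : Finset (ℤ × ℤ)}
    (hX : IsLocal X D) (hcount : X.Countable) {v w : ℤ × ℤ} (h : Frame v w) {K : ℤ}
    (hK : 0 < K) {c : Config α} (hcX : c ∈ X) (hc : Per (K • v) c) :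
    ∃ L T : ℤ, 0 < L ∧ ∀ u, T ≤ rowHom v u → c (u + L • w) = c u := by
  obtain ⟨r, hr⟩ := hX.exists_rowLocal (rowHom v)
  obtain ⟨S, hS, hSc⟩ := h.exists_infinite_same_state hK hc r
  obtain ⟨m, hm⟩ := hS.nonempty
  obtain ⟨n, hn, hmn⟩ := hS.exists_gt m
  refine ⟨n - m, m, by omega, fun u hu => ?_⟩
  obtain ⟨p, hp, hpb⟩ := hS.exists_gt (m + n + r + (rowHom v u).toNat)
  have h1 : rowHom v (u - (m : ℤ) • w) = rowHom v u - m := by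
    rw [map_sub, map_zsmul, h, smul_eq_mul, mul_one]
  have := hr.eq_of_three_states hcount h hcX (m := m) (n := n) (p := p) (by omega) (by omega)
    (by omega) (hSc m hm n hn) (hSc m hm p hp) (u := u - (m : ℤ) • w) (by omega) (by omega)
  rw [sub_add_cancel] at this
  rw [this]
  congr 1
  module

/-- A row-periodic configuration that is approximated on wide strips by doubly periodic ones
is doubly periodic. -/
theorem IsLocal.exists_per_of_approx [Finite α] {X : Set (Config α)} {D : Finset (ℤ × ℤ)}
    (hX : IsLocal X D) (hcount : X.Countable) {v w : ℤ × ℤ} (h : Frame v w) {K : ℤ}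
    (hK : 0 < K) {y : Config α} (hy : Per (K • v) y)
    (H : ∀ N : ℕ, ∃ z ∈ X, FullPer z ∧ ∀ u, |rowHom v u| ≤ N → z u = y u) :
    ∃ L : ℤ, 0 < L ∧ Per (L • w) y := by
  obtain ⟨r, hr⟩ := hX.exists_rowLocal (rowHom v)
  obtain ⟨S, hS, hSc⟩ := h.exists_infinite_same_state hK hy r
  obtain ⟨m, hm⟩ := hS.nonempty
  obtain ⟨n, hn, hmn⟩ := hS.exists_gt m
  have hrow : ∀ (u : ℤ × ℤ) (k : ℤ), rowHom v (u + k • w) = rowHom v u + k := fun u k => by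
    rw [map_add, map_zsmul, h, smul_eq_mul, mul_one]
  refine ⟨n - m, by omega, fun u => ?_⟩
  obtain ⟨z, hzX, hz, hzy⟩ := H (n + r + (rowHom v u).natAbs)
  have hzmn : ∀ u, |rowHom v u| ≤ r → z (u + (m : ℤ) • w) = z (u + (n : ℤ) • w) := by
    intro u hu
    rw [abs_le] at hu
    rw [hzy, hzy, hSc m hm n hn u (abs_le.2 hu)] <;>
    · rw [hrow, abs_le]
      constructor <;> omega
  obtain ⟨G, hG, hGz⟩ := hz w
  have hright : ∀ u, 0 ≤ rowHom v u → z (u + (m : ℤ) • w) = z (u + (n : ℤ) • w) := by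
    intro u hu
    have hle : n + r + rowHom v u + 1 ≤ (n + r + rowHom v u + 1) * G := by
      nlinarith
    refine hr.eq_of_three_states hcount h hzX (m := m) (n := n)
      (p := m + (n + r + rowHom v u + 1) * G) (by omega) (by omega) (by omega) hzmn ?_ hu
      (by omega)
    intro u' _
    rw [← (hGz.zsmul (n + r + rowHom v u + 1)) (u' + _)]
    congr 1
    module
  have hzper : z (u + ((n : ℤ) - m) • w) = z u := by
    set j : ℤ := m + |rowHom v u|
    have hj : 0 ≤ j := by positivity
    have h1 := hright (u - (m : ℤ) • w + j • G • w) (by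
      rw [map_add, map_sub, map_zsmul, map_zsmul, map_zsmul, h]
      simp only [smul_eq_mul, mul_one]
      have := neg_abs_le (rowHom v u)
      nlinarith)
    rw [← (hGz.zsmul j) u, ← (hGz.zsmul j) (u + _)]
    convert h1.symm using 2 <;> module
  rw [← hzy u, ← hzy, hzper]
  · rw [hrow, abs_le]
    constructor <;> omega
  · rw [abs_le]
    constructor <;> omega

/-- If `d` occurs in `c` arbitrarily far across the rows, then it inherits the transversal
eventual periodicity of `c`. -/
theorem IsLocal.fullPer_of_far [Finite α] {X : Set (Config α)} {D : Finset (ℤ × ℤ)}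
    (hX : IsLocal X D) (hcount : X.Countable) {v w : ℤ × ℤ} (h : Frame v w) {K : ℤ}
    (hK : 0 < K) {c d : Config α} (hcX : c ∈ X) (hc : Per (K • v) c) (hd : Per (K • v) d)
    (H : ∀ (E : Finset (ℤ × ℤ)) (T : ℤ), ∃ u, T ≤ rowHom v u ∧ ∀ e ∈ E, c (e + u) = d e) :
    FullPer d := by
  classical
  obtain ⟨L, T, hL, hLc⟩ := hX.exists_eventually_per hcount h hK hcX hc
  refine h.fullPer hK hL hd fun q => ?_
  obtain ⟨u, hu, hucd⟩ := H {q, q + L • w} (T - rowHom v q)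
  rw [← hucd q (by simp), ← hucd (q + L • w) (by simp), ← hLc (q + u)]
  · congr 1
    abel
  · rw [map_add]
    linarith

variable [TopologicalSpace α]

theorem exists_agree_subset {x : Config α} {U : Set (Config α)} (hU : IsOpen U) (hx : x ∈ U) :
    ∃ E : Finset (ℤ × ℤ), ∀ y : Config α, (∀ e ∈ E, y e = x e) → y ∈ U := by
  obtain ⟨E, t, ht, hsub⟩ := isOpen_pi_iff.1 hU x hx
  refine ⟨E, fun y hy => hsub fun e he => ?_⟩
  rw [hy e he]
  exact (ht e he).2

theorem preceq_shift_self (v : ℤ × ℤ) (x : Config α) : Preceq (shift v x) x :=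
  subset_closure ⟨v, rfl⟩

theorem preceq_self_shift (v : ℤ × ℤ) (x : Config α) : Preceq x (shift v x) := by
  have := preceq_shift_self (-v) (shift v x)
  rw [shift_shift] at this
  convert this using 1
  funext u
  simp [shift]

variable [DiscreteTopology α]

theorem isOpen_agree (x : Config α) (E : Finset (ℤ × ℤ)) :
    IsOpen {y : Config α | ∀ e ∈ E, y e = x e} := by
  have : {y : Config α | ∀ e ∈ E, y e = x e} = ⋂ e ∈ E, (fun y : Config α => y e) ⁻¹' {x e} := by
    ext y; simp
  rw [this]
  exact isOpen_biInter_finset fun e _ => (isOpen_discrete _).preimage (continuous_apply e)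

theorem preceq_iff {x y : Config α} :
    Preceq x y ↔ ∀ E : Finset (ℤ × ℤ), ∃ u, ∀ e ∈ E, y (e + u) = x e := by
  rw [Preceq, mem_closure_iff]
  constructor
  · intro h E
    obtain ⟨-, h1, u, rfl⟩ := h _ (isOpen_agree x E) fun e _ => rfl
    exact ⟨u, h1⟩
  · intro h U hU hx
    obtain ⟨E, hE⟩ := exists_agree_subset hU hx
    obtain ⟨u, hu⟩ := h E
    exact ⟨shift u y, hE _ hu, u, rfl⟩

theorem Preceq.trans {x y z : Config α} (hxy : Preceq x y) (hyz : Preceq y z) : Preceq x z := by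
  classical
  rw [preceq_iff] at *
  intro E
  obtain ⟨u, hu⟩ := hxy E
  obtain ⟨v, hv⟩ := hyz (E.image (· + u))
  refine ⟨u + v, fun e he => ?_⟩
  rw [← hu e he, ← hv _ (Finset.mem_image_of_mem _ he), add_assoc]

theorem preceq_refl (x : Config α) : Preceq x x :=
  preceq_iff.2 fun _ => ⟨0, fun e _ => by rw [add_zero]⟩

theorem IsClus.preceq {x : ℕ → Config α} {w y : Config α} (hw : IsClus x w)
    (hx : ∀ᶠ n in atTop, Preceq (x n) y) : Preceq w y := by
  refine preceq_iff.2 fun E => ?_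
  obtain ⟨n, hn, hny⟩ := ((hw E).and_eventually hx).exists
  obtain ⟨u, hu⟩ := preceq_iff.1 hny E
  exact ⟨u, fun e he => (hu e he).trans (hn e he)⟩

theorem IsLocal.mem_of_preceq {X : Set (Config α)} {D : Finset (ℤ × ℤ)} (hX : IsLocal X D)
    {x y : Config α} (hx : x ∈ X) (hy : Preceq y x) : y ∈ X := by
  classical
  refine hX.loc y fun u => ?_
  obtain ⟨v, hv⟩ := preceq_iff.1 hy (D.image (u + ·))
  exact ⟨shift v x, hX.inv x hx v, fun d hd => (hv _ (Finset.mem_image_of_mem _ hd)).symm⟩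

theorem exists_isClus [Finite α] (x : ℕ → Config α) : ∃ w, IsClus x w := by
  obtain ⟨w, hw⟩ := exists_clusterPt_of_compactSpace (map x atTop)
  refine ⟨w, fun E => ?_⟩
  exact (mapClusterPt_iff_frequently.1 hw) _ ((isOpen_agree w E).mem_nhds fun e _ => rfl)

theorem exists_isolating [Finite α] {X : Set (Config α)} {D : Finset (ℤ × ℤ)} (hX : IsLocal X D)
    (hcount : X.Countable) {x : Config α} (hx : x ∈ X) :
    ∃ E : Finset (ℤ × ℤ), ∀ y, Preceq y x → (∀ e ∈ E, y e = x e) → y = x := by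
  classical
  let C := closure (orbit x)
  have hCX : C ⊆ X := fun y hy => hX.mem_of_preceq hx hy
  have : Countable C := (hcount.mono hCX).to_subtype
  have : CompactSpace C := isCompact_iff_compactSpace.1 isClosed_closure.isCompact
  have : Nonempty C := ⟨⟨x, preceq_refl x⟩⟩
  obtain ⟨z, hz⟩ := nonempty_interior_of_iUnion_of_closed (f := fun z : C => {z})
    (fun z => isClosed_singleton) (by ext; simp)
  have hzo : IsOpen ({z} : Set C) := by
    rw [← interior_eq_iff_isOpen]
    exact (Set.subset_singleton_iff_eq.1 interior_subset).resolve_left hz.ne_empty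
  obtain ⟨U, hU, hUz⟩ := isOpen_induced_iff.1 hzo
  have hUC : ∀ y ∈ C, y ∈ U → y = z.1 := by
    intro y hy hyU
    have : (⟨y, hy⟩ : C) ∈ ({z} : Set C) := by rw [← hUz]; exact hyU
    exact congrArg Subtype.val this
  have hzU : z.1 ∈ U := by
    have : z ∈ (Subtype.val ⁻¹' U : Set C) := by rw [hUz]; rfl
    exact this
  obtain ⟨E, hE⟩ := exists_agree_subset hU hzU
  obtain ⟨a, ha⟩ := preceq_iff.1 z.2 E
  have hza : shift a x = z.1 := hUC _ (preceq_shift_self a x) (hE _ ha)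
  refine ⟨E.image (· + a), fun y hy hyx => ?_⟩
  have : shift a y = z.1 := by
    refine hUC _ ((preceq_shift_self a y).trans hy) (hE _ fun e he => ?_)
    rw [← ha e he]
    exact hyx _ (Finset.mem_image_of_mem _ he)
  rw [← hza] at this
  funext u
  simpa [shift] using congrFun this (u - a)

theorem frequently_per [Finite α] {X : Set (Config α)} {D : Finset (ℤ × ℤ)} (hX : IsLocal X D)
    (hcount : X.Countable) {x : Config α} (hx : x ∈ X) {u : ℕ → ℤ × ℤ} {w : Config α}
    (hw : IsClus (fun n => shift (u n) x) w) (hxw : Preceq x w) :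
    ∃ a, ∃ᶠ n in atTop, Per (u n + a) x := by
  classical
  obtain ⟨E, hE⟩ := exists_isolating hX hcount hx
  obtain ⟨a, ha⟩ := preceq_iff.1 hxw E
  refine ⟨a, (hw (E.image (· + a))).mono fun n hn => ?_⟩
  rw [← shift_eq_self_iff]
  refine hE _ (preceq_shift_self _ _) fun e he => ?_
  rw [← ha e he, ← hn _ (Finset.mem_image_of_mem _ he)]
  simp only [shift]
  congr 1
  abel

theorem IsLocal.clus_level0_or_per [Finite α] {X : Set (Config α)} {D : Finset (ℤ × ℤ)}
    (hX : IsLocal X D) (hcount : X.Countable) {x : Config α} (hx : Level0 X x ∨ Level1 X x)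
    {u : ℕ → ℤ × ℤ} {w : Config α} (hw : IsClus (fun n => shift (u n) x) w) :
    Level0 X w ∨ ∃ a, ∃ᶠ n in atTop, Per (u n + a) x := by
  have hxX : x ∈ X := hx.elim (·.1) (·.1)
  have hwx : Preceq w x := hw.preceq (.of_forall fun n => preceq_shift_self _ _)
  have hwX : w ∈ X := hX.mem_of_preceq hxX hwx
  by_cases hxw : Preceq x w
  · exact .inr (frequently_per hX hcount hxX hw hxw)
  · refine .inl (hx.elim (fun h => absurd (h.2 w hwX hwx) hxw) fun h => h.2.2 w hwX ⟨hwx, hxw⟩)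

theorem Level0.fullPer [Finite α] {X : Set (Config α)} {D : Finset (ℤ × ℤ)} (hX : IsLocal X D)
    (hcount : X.Countable) {x : Config α} (hx : Level0 X x) : FullPer x := by
  intro v
  obtain ⟨w, hw⟩ := exists_isClus fun n : ℕ => shift ((n : ℤ) • v) x
  have hwx : Preceq w x := hw.preceq (.of_forall fun n => preceq_shift_self _ _)
  obtain ⟨a, ha⟩ := frequently_per hX hcount hx.1 hw
    (hx.2 w (hX.mem_of_preceq hx.1 hwx) hwx)
  exact exists_per_of_frequently ha

theorem FullPer.level0 {X : Set (Config α)} {x : Config α} (hx : x ∈ X) (hp : FullPer x) :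
    Level0 X x := by
  classical
  obtain ⟨k, hk, hkx⟩ := hp (1, 0)
  obtain ⟨l, hl, hlx⟩ := hp (0, 1)
  refine ⟨hx, fun y _ hyx => ?_⟩
  obtain ⟨s, rfl⟩ := exists_shift_eq (x := x) (y := y)
    ((Finset.Icc 0 k) ×ˢ (Finset.Icc 0 l)) fun E => by
      obtain ⟨u, hu⟩ := preceq_iff.1 hyx E
      refine ⟨(u.1 % k, u.2 % l), ?_, fun e he => ?_⟩
      · simp only [Finset.mem_product, Finset.mem_Icc]
        exact ⟨⟨Int.emod_nonneg _ hk.ne', (Int.emod_lt_of_pos _ hk).le⟩,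
          ⟨Int.emod_nonneg _ hl.ne', (Int.emod_lt_of_pos _ hl).le⟩⟩
      · rw [← hu e he, ← ((hkx.zsmul (u.1 / k)).add (hlx.zsmul (u.2 / l))) (e + _)]
        congr 1
        ext
        · simp; linarith [Int.emod_add_mul_ediv u.1 k, mul_comm k (u.1 / k)]
        · simp; linarith [Int.emod_add_mul_ediv u.2 l, mul_comm l (u.2 / l)]
  exact preceq_self_shift s x

/-- A family of configurations whose limits are all periodic along `v` is, far enough in the
family, uniformly periodic along `v`. -/
theorem exists_uniform_period [Finite α] (v : ℤ × ℤ) (P : ℕ → Set (Config α)) (hP : Antitone P)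
    (H : ∀ x w, (∀ n, x n ∈ P n) → IsClus x w → ∃ k : ℤ, 0 < k ∧ Per (k • v) w) :
    ∃ K n : ℕ, 0 < K ∧ ∀ x, (∀ t : ℕ, shift ((t : ℤ) • v) x ∈ P n) →
      x ((K : ℤ) • v) = x 0 := by
  classical
  by_contra! hne
  choose x hx hxne using fun n => hne n.factorial n n.factorial_pos
  obtain ⟨w, hw⟩ := exists_isClus x
  obtain ⟨k, hk, hkw⟩ := H x w (fun n => by
    have := hx n 0
    rwa [Nat.cast_zero, zero_smul, shift_eq_self_iff.2 (Per.zero _)] at this) hw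
  lift k to ℕ using hk.le
  have hk' : 0 < k := by exact_mod_cast hk
  have step : ∀ m : ℕ, ∃ y ∈ P m, ∀ t : ℕ, 1 ≤ t → t ≤ m →
      y (-((t * k : ℕ) : ℤ) • v) ≠ y 0 := by
    intro m
    obtain ⟨n, hn, hnw⟩ := hw.exists_ge
      ((Finset.range (m + 1)).image fun t : ℕ => (((t * k : ℕ) : ℤ) • v)) (m + k)
    have hex : ∃ j : ℕ, x n (((j * k : ℕ) : ℤ) • v) ≠ x n 0 := by
      obtain ⟨j, hj⟩ := Nat.dvd_factorial hk' (show k ≤ n by omega)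
      exact ⟨j, by rw [mul_comm, ← hj]; exact hxne n⟩
    have hlt : ∀ j ≤ m, x n (((j * k : ℕ) : ℤ) • v) = x n 0 := by
      intro j hj
      have h0 := hnw _ (Finset.mem_image_of_mem _ (Finset.mem_range.2 (Nat.succ_pos m)))
      rw [hnw _ (Finset.mem_image_of_mem _ (Finset.mem_range.2 (Nat.lt_succ_of_le hj)))]
      simp only [zero_mul, Nat.cast_zero, zero_smul] at h0
      rw [h0, ← (hkw.zsmul j) 0]
      congr 1
      push_cast
      module
    have hj := Nat.find_spec hex
    set j := Nat.find hex with hjdef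
    have hmj : m < j := by
      by_contra! h
      exact hj (hlt j h)
    refine ⟨shift (((j * k : ℕ) : ℤ) • v) (x n), hP (by omega : m ≤ n) (hx n _), ?_⟩
    intro t ht htm h
    have h1 : x n ((((j - t) * k : ℕ) : ℤ) • v) = x n 0 :=
      not_not.1 (Nat.find_min hex (show j - t < j by omega))
    apply hj
    rw [← h1]
    simp only [shift, zero_add] at h
    rw [← h]
    congr 1
    push_cast [Nat.cast_sub (show t ≤ j by omega)]
    module
  choose y hy hyne using step
  obtain ⟨w', hw'⟩ := exists_isClus y
  obtain ⟨k', hk', hkw'⟩ := H y w' hy hw'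
  lift k' to ℕ using hk'.le
  obtain ⟨n, hn, hnw⟩ := hw'.exists_ge {-((k' * k : ℕ) : ℤ) • v, 0} k'
  refine hyne n k' (by exact_mod_cast hk') hn ?_
  rw [hnw _ (by simp), hnw 0 (by simp), ← (hkw'.zsmul k) _]
  congr 1
  push_cast
  module

/-- Below a configuration with a period there are only minimal configurations. -/
theorem IsLocal.level0_of_prec [Finite α] {X : Set (Config α)} {D : Finset (ℤ × ℤ)}
    (hX : IsLocal X D) (hcount : X.Countable) {p : ℤ × ℤ} (hp : p ≠ 0) {c d : Config α}
    (hcX : c ∈ X) (hc : Per p c) (hdc : Prec d c) : Level0 X d := by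
  classical
  obtain ⟨v, w, K, hK, h, rfl⟩ := exists_frame hp
  have hd : Per (K • v) d := by
    intro q
    obtain ⟨u, hu⟩ := preceq_iff.1 hdc.1 {q, q + K • v}
    rw [← hu q (by simp), ← hu (q + K • v) (by simp), ← hc (q + u)]
    congr 1
    abel
  refine FullPer.level0 (hX.mem_of_preceq hcX hdc.1) ?_
  by_contra hnot
  have h1 := mt (hX.fullPer_of_far hcount h hK hcX hc hd) hnot
  have h2 := mt (hX.fullPer_of_far hcount h.neg hK hcX (by simpa using hc.neg)
    (by simpa using hd.neg)) hnot
  push Not at h1 h2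
  obtain ⟨E₁, T₁, h1⟩ := h1
  obtain ⟨E₂, T₂, h2⟩ := h2
  obtain ⟨s, rfl⟩ := exists_shift_eq (x := c) (y := d)
    ((Finset.Icc 0 K ×ˢ Finset.Icc (-T₂) T₁).image fun it => it.1 • v + it.2 • w) fun E => by
      obtain ⟨u, hu⟩ := preceq_iff.1 hdc.1 (E ∪ (E₁ ∪ E₂))
      have hu1 : rowHom v u < T₁ := by
        by_contra! hT
        obtain ⟨e, he, hne⟩ := h1 u hT
        exact hne (hu e (by simp [he]))
      have hu2 : rowHom (-v) u < T₂ := by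
        by_contra! hT
        obtain ⟨e, he, hne⟩ := h2 u hT
        exact hne (hu e (by simp [he]))
      rw [rowHom_neg] at hu2
      obtain ⟨a, b, ha, haK, hab⟩ := h.exists_decomp_mod hK u
      refine ⟨_, Finset.mem_image.2 ⟨(a, rowHom v u), ?_, rfl⟩, fun e he => ?_⟩
      · simp only [Finset.mem_product, Finset.mem_Icc]
        omega
      · rw [← hu e (by simp [he]), ← (hc.zsmul b) (e + _)]
        congr 1
        conv_rhs => rw [hab]
        abel
  exact hdc.2 (preceq_self_shift s c)

/-- A configuration that is periodic along both axes outside a square is periodic. -/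
theorem IsLocal.per_of_per_outside [Finite α] {X : Set (Config α)} {D : Finset (ℤ × ℤ)}
    (hX : IsLocal X D) (hcount : X.Countable) {x : Config α} (hx : x ∈ X) {K R : ℤ} (hK : 0 < K)
    (hR : 0 ≤ R)
    (h₁ : ∀ u : ℤ × ℤ, R ≤ |u.1| ∨ R ≤ |u.2| → x (u + (K, 0)) = x u)
    (h₂ : ∀ u : ℤ × ℤ, R ≤ |u.1| ∨ R ≤ |u.2| → x (u + (0, K)) = x u) : Per (K, 0) x := by
  classical
  have h₁row : ∀ (u : ℤ × ℤ), R ≤ |u.2| → ∀ n : ℕ, x (u + ((n : ℤ) * K, 0)) = x u := by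
    intro u hu n
    induction n with
    | zero => simp [Prod.mk_zero_zero]
    | succ n ih =>
      rw [← ih, ← h₁ (u + ((n : ℤ) * K, 0)) (.inr (by simpa using hu))]
      congr 1
      ext <;> simp
      ring
  have h₂col : ∀ (u : ℤ × ℤ), R ≤ |u.1| → ∀ n : ℕ, x (u + (0, (n : ℤ) * K)) = x u := by
    intro u hu n
    induction n with
    | zero => simp [Prod.mk_zero_zero]
    | succ n ih =>
      rw [← ih, ← h₂ (u + (0, (n : ℤ) * K)) (.inl (by simpa using hu))]
      congr 1
      ext <;> simp
      ring
  obtain ⟨f, hf⟩ := exists_isClus fun n : ℕ => shift ((n : ℤ) * K, 0) x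
  have hfX : f ∈ X := hX.clus_mem (fun n => hX.inv x hx _) hf
  have hfar : ∀ u : ℤ × ℤ, ∀ n : ℕ, (R + |u.1|).toNat ≤ n → R ≤ u.1 + n * K := by
    intro u n hn
    have := neg_abs_le u.1
    have h1 : R + |u.1| ≤ n := by omega
    nlinarith
  have hf₁ : Per (K, 0) f := by
    intro u
    obtain ⟨n, hn, hnf⟩ := hf.exists_ge {u, u + (K, 0)} (R + |u.1|).toNat
    rw [← hnf u (by simp), ← hnf (u + (K, 0)) (by simp)]
    simp only [shift]
    rw [add_right_comm, h₁ _ (.inl (le_trans (by simpa using hfar u n hn) (le_abs_self _)))]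
  have hf₂ : Per (0, K) f := by
    intro u
    obtain ⟨n, hn, hnf⟩ := hf.exists_ge {u, u + (0, K)} (R + |u.1|).toNat
    rw [← hnf u (by simp), ← hnf (u + (0, K)) (by simp)]
    simp only [shift]
    rw [add_right_comm, h₂ _ (.inl (le_trans (by simpa using hfar u n hn) (le_abs_self _)))]
  have hxrow : ∀ u : ℤ × ℤ, R ≤ |u.2| → x u = f u := by
    intro u hu
    obtain ⟨n, -, hnf⟩ := hf.exists_ge {u} 0
    rw [← hnf u (by simp)]
    exact (h₁row u hu n).symm
  have hxcol : ∀ u : ℤ × ℤ, R ≤ |u.1| → x u = f u := by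
    intro u hu
    rw [← h₂col u hu (R + |u.2|).toNat, hxrow]
    · have := (hf₂.zsmul (R + |u.2|).toNat) u
      rw [← this]
      simp
    · have := hfar u.swap (R + |u.2|).toNat le_rfl
      exact le_trans (by simpa using this) (le_abs_self _)
  have hframe : Frame (0, -1) (1, 0) := by simp [Frame, rowHom]
  have hrow : ∀ u, rowHom (0, -1) u = u.1 := by simp [rowHom]
  obtain ⟨r, hr⟩ := hX.exists_rowLocal (rowHom (0, -1))
  have hM : 2 * (R + r) + 1 ≤ (2 * (R + r) + 1) * K := by nlinarith
  set B : ℤ := (2 * (R + r) + 1) * K with hB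
  have hfB : Per (B, 0) f := by simpa [hB] using hf₁.zsmul (2 * (R + r) + 1)
  suffices hxf : x = f by rw [hxf]; exact hf₁
  funext u
  by_cases hu : R ≤ |u.1|
  · exact hxcol u hu
  have hu' := abs_lt.1 (not_le.1 hu)
  have hpaste := hr.eq_of_paste hcount (W := (B, 0)) (by rw [hrow]; simp only; omega)
    (by rw [hrow]; simp only; omega) (hX.inv x hx (-(R + r), 0))
    (hX.inv f hfX (-(R + r), 0)) ?_ ?_ ?_ (u := u + (R + r, 0))
    (by rw [hrow]; simp only [Prod.fst_add]; omega)
    (by rw [hrow, hrow]; simp only [Prod.fst_add]; omega)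
  · simpa [shift, add_assoc, Prod.mk_zero_zero] using hpaste
  · intro u hu
    rw [hrow, abs_le] at hu
    refine hxcol _ (le_trans ?_ (neg_le_abs _))
    simp only [Prod.fst_add]
    omega
  · intro u hu
    rw [hrow, abs_le] at hu
    simp only [shift]
    rw [hxcol (u + _ + _), hxcol (u + _), add_right_comm, hfB]
    · refine le_trans ?_ (neg_le_abs _)
      simp only [Prod.fst_add]
      omega
    · refine le_trans ?_ (le_abs_self _)
      simp only [Prod.fst_add]
      omega
  · intro u _
    simp only [shift]
    rw [add_right_comm, hfB]

theorem exists_per_along_axis [Finite α] {x : Config α}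
    (H : ∀ (u : ℕ → ℤ × ℤ) (w : Config α), (∀ n : ℕ, (n : ℤ) ≤ |(u n).1| ∨ (n : ℤ) ≤ |(u n).2|) →
      IsClus (fun n => shift (u n) x) w → FullPer w) (v : ℤ × ℤ) :
    ∃ K n : ℕ, 0 < K ∧ ∀ u : ℤ × ℤ, (∀ t : ℕ,
      (n : ℤ) ≤ |(u + (t : ℤ) • v).1| ∨ (n : ℤ) ≤ |(u + (t : ℤ) • v).2|) →
      ∀ j : ℕ, x (u + ((j : ℤ) * K) • v) = x u := by
  obtain ⟨K, n, hK, h⟩ := exists_uniform_period (α := α) v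
    (fun n => {y | ∃ u : ℤ × ℤ, ((n : ℤ) ≤ |u.1| ∨ (n : ℤ) ≤ |u.2|) ∧ y = shift u x})
    (fun m n hmn y ⟨u, hu, hy⟩ => ⟨u, by omega, hy⟩)
    (fun y w hy hw => by
      choose u hu hyu using hy
      obtain rfl : y = fun n => shift (u n) x := funext hyu
      exact H u w hu hw v)
  refine ⟨K, n, hK, fun u hu j => ?_⟩
  have hstep : ∀ s : ℕ, x (u + (s : ℤ) • v + (K : ℤ) • v) = x (u + (s : ℤ) • v) := by
    intro s
    have := h (shift (u + (s : ℤ) • v) x) fun t =>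
      ⟨u + ((t + s : ℕ) : ℤ) • v, hu _, by
        rw [shift_shift]; congr 1; push_cast; module⟩
    simpa [shift, add_comm] using this
  induction j with
  | zero => simp
  | succ j ih =>
    rw [← ih]
    have := hstep (j * K)
    push_cast at this
    rw [← this]
    congr 1
    push_cast
    module

/-- Configurations at level at most one have a nonzero period. -/
theorem IsLocal.exists_per [Finite α] {X : Set (Config α)} {D : Finset (ℤ × ℤ)}
    (hX : IsLocal X D) (hcount : X.Countable) {x : Config α} (hx : Level0 X x ∨ Level1 X x) :
    ∃ p : ℤ × ℤ, p ≠ 0 ∧ Per p x := by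
  classical
  by_contra! hno
  have H : ∀ (u : ℕ → ℤ × ℤ) (w : Config α),
      (∀ n : ℕ, (n : ℤ) ≤ |(u n).1| ∨ (n : ℤ) ≤ |(u n).2|) →
      IsClus (fun n => shift (u n) x) w → FullPer w := by
    intro u w hu hw
    refine (hX.clus_level0_or_per hcount hx hw).elim (fun h => h.fullPer hX hcount) ?_
    rintro ⟨a, ha⟩
    obtain ⟨n, hn, hna⟩ := frequently_atTop.1 ha (a.1.natAbs + a.2.natAbs + 1)
    have h0 : u n + a = 0 := by
      by_contra h0
      exact hno _ h0 hna
    have h1 := congrArg Prod.fst h0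
    have h2 := congrArg Prod.snd h0
    simp only [Prod.fst_add, Prod.snd_add, Prod.fst_zero, Prod.snd_zero] at h1 h2
    have := hu n
    rw [Int.abs_eq_natAbs, Int.abs_eq_natAbs] at this
    omega
  obtain ⟨K₁, n₁, hK₁, h₁⟩ := exists_per_along_axis H (1, 0)
  obtain ⟨K₂, n₂, hK₂, h₂⟩ := exists_per_along_axis H (-1, 0)
  obtain ⟨K₃, n₃, hK₃, h₃⟩ := exists_per_along_axis H (0, 1)
  obtain ⟨K₄, n₄, hK₄, h₄⟩ := exists_per_along_axis H (0, -1)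
  simp only [Int.abs_eq_natAbs, Prod.fst_add, Prod.snd_add, Prod.smul_mk, smul_eq_mul, mul_one,
    mul_zero, mul_neg, add_zero] at h₁ h₂ h₃ h₄
  set K : ℕ := K₁ * K₂ * K₃ * K₄ with hKdef
  have hK : 0 < K := by positivity
  have hper := hX.per_of_per_outside hcount (x := x) (K := K)
    (R := n₁ + n₂ + n₃ + n₄ + K) (hx.elim (·.1) (·.1)) (by omega) (by omega) ?_ ?_
  · exact hno _ (by simp [Prod.ext_iff]; omega) hper
  · intro u hu
    simp only [Int.abs_eq_natAbs] at hu
    by_cases hu0 : 0 ≤ u.1 ∨ (n₁ : ℤ) ≤ |u.2|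
    · simp only [Int.abs_eq_natAbs] at hu0
      rw [← h₁ u (fun t => by omega) (K₂ * K₃ * K₄)]
      congr 1
      ext
      · simp [hKdef]; ring
      · simp
    · simp only [Int.abs_eq_natAbs] at hu0
      have := h₂ (u + ((K : ℤ), 0)) (fun t => by simp only [Prod.fst_add, Prod.snd_add]; omega)
        (K₁ * K₃ * K₄)
      rw [← this]
      congr 1
      ext
      · simp [hKdef]; ring
      · simp
  · intro u hu
    simp only [Int.abs_eq_natAbs] at hu
    by_cases hu0 : 0 ≤ u.2 ∨ (n₃ : ℤ) ≤ |u.1|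
    · simp only [Int.abs_eq_natAbs] at hu0
      rw [← h₃ u (fun t => by omega) (K₁ * K₂ * K₄)]
      congr 1
      ext
      · simp
      · simp [hKdef]; ring
    · simp only [Int.abs_eq_natAbs] at hu0
      have := h₄ (u + (0, (K : ℤ))) (fun t => by simp only [Prod.fst_add, Prod.snd_add]; omega)
        (K₁ * K₂ * K₃)
      rw [← this]
      congr 1
      ext
      · simp
      · simp [hKdef]

/-- A `Preceq`-decreasing sequence all of whose lower bounds are at level at most one. -/
structure LowChain (X : Set (Config α)) (c : ℕ → Config α) : Prop where
  anti : ∀ i j, i ≤ j → Preceq (c j) (c i)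
  low : ∀ y, (∀ i, Preceq y (c i)) → Level0 X y ∨ Level1 X y

theorem LowChain.clus_preceq {X : Set (Config α)} {c : ℕ → Config α} (hc : LowChain X c)
    {i : ℕ → ℕ} (hi : ∀ n, n ≤ i n) {u : ℕ → ℤ × ℤ} {w : Config α}
    (hw : IsClus (fun n => shift (u n) (c (i n))) w) (j : ℕ) : Preceq w (c j) :=
  hw.preceq ((eventually_ge_atTop j).mono fun n hn =>
    (preceq_shift_self _ _).trans (hc.anti _ _ (hn.trans (hi n))))

/-- Either a long repetition of a pattern along `p` in a late term of the chain continues forever,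
or the infinite repetition of that pattern occurs in a minimal configuration. -/
theorem LowChain.extend_or_level0 [Finite α] {X : Set (Config α)} {D : Finset (ℤ × ℤ)}
    (hX : IsLocal X D) (hcount : X.Countable) {c : ℕ → Config α} (hc : LowChain X c)
    (y : Config α) (p : ℤ × ℤ) (E : Finset (ℤ × ℤ)) :
    (∃ m : ℕ, ∀ i ≥ m, ∀ u,
      (∀ t : ℕ, t ≤ m → ∀ e ∈ E, c i (e + (t : ℤ) • p + u) = y e) →
        ∀ t : ℕ, ∀ e ∈ E, c i (e + (t : ℤ) • p + u) = y e) ∨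
    ∃ z, Level0 X z ∧ ∀ e ∈ E, ∀ t : ℤ, z (e + t • p) = y e := by
  classical
  by_contra! ⟨h1, h2⟩
  have step : ∀ m : ℕ, ∃ i u, m ≤ i ∧
      (∀ t : ℕ, 1 ≤ t → t ≤ m → ∀ e ∈ E, c i (e - (t : ℤ) • p + u) = y e) ∧
      ∃ e ∈ E, c i (e + u) ≠ y e := by
    intro m
    obtain ⟨i, hi, u, hu, hex⟩ := h1 m
    refine ⟨i, (Nat.find hex : ℤ) • p + u, hi, fun t ht htm e he => ?_, ?_⟩
    · have hm : m < Nat.find hex := by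
        by_contra! hle
        obtain ⟨e, he, hne⟩ := Nat.find_spec hex
        exact hne (hu _ hle e he)
      have := Nat.find_min hex (show Nat.find hex - t < Nat.find hex by omega)
      push Not at this
      rw [← this e he]
      congr 1
      push_cast [Nat.cast_sub (show t ≤ Nat.find hex by omega)]
      module
    · simpa only [add_assoc] using Nat.find_spec hex
  choose i u hi hback e he hne using step
  obtain ⟨w, hw⟩ := exists_isClus fun n => shift (u n) (c (i n))
  have hwback : ∀ t : ℕ, 1 ≤ t → ∀ e ∈ E, w (e - (t : ℤ) • p) = y e := by
    intro t ht e he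
    obtain ⟨n, hn, hnw⟩ := hw.exists_ge {e - (t : ℤ) • p} t
    rw [← hnw _ (by simp)]
    exact hback n t ht hn e he
  obtain ⟨e, he, hne⟩ : ∃ e ∈ E, w e ≠ y e := by
    obtain ⟨n, -, hnw⟩ := hw.exists_ge E 0
    exact ⟨e n, he n, by rw [← hnw _ (he n)]; exact hne n⟩
  obtain ⟨z, hz⟩ := exists_isClus fun n : ℕ => shift ((n : ℤ) • (-p)) w
  rcases hX.clus_level0_or_per hcount (hc.low w (hc.clus_preceq hi hw)) hz with h0 | ⟨a, ha⟩
  · obtain ⟨e, he, t, hne⟩ := h2 z h0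
    obtain ⟨n, hn, hnz⟩ := hz.exists_ge {e + t • p} (t.toNat + 1)
    apply hne
    rw [← hnz _ (by simp), ← hwback (n - t).toNat (by omega) e he]
    simp only [shift]
    congr 1
    rw [Int.toNat_of_nonneg (by omega)]
    module
  · obtain ⟨k, hk, hkw⟩ := exists_per_of_frequently ha
    apply hne
    rw [← hwback k.toNat (by omega) e he, ← hkw e]
    congr 1
    rw [Int.toNat_of_nonneg hk.le]
    module

/-- Late terms of the chain contain infinite strips of any lower bound that is not minimal. -/
theorem LowChain.exists_strip [Finite α] {X : Set (Config α)} {D : Finset (ℤ × ℤ)}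
    (hX : IsLocal X D) (hcount : X.Countable) {c : ℕ → Config α} (hc : LowChain X c)
    {y : Config α} (hy : ∀ i, Preceq y (c i)) {p : ℤ × ℤ} (hp : p ≠ 0)
    (hyp : Per p y) (hnot : ¬ FullPer y) (E : Finset (ℤ × ℤ)) :
    ∃ i₀, ∀ i ≥ i₀, ∃ u, ∀ t : ℤ, ∀ e ∈ E, c i (e + t • p + u) = y e := by
  classical
  obtain ⟨v, w, K, hK, h, rfl⟩ := exists_frame hp
  have hno : ¬ ∃ L : ℤ, 0 < L ∧ Per (L • w) y := fun ⟨L, hL, hyL⟩ =>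
    hnot (h.fullPer hK hL hyp hyL)
  have happrox := mt (hX.exists_per_of_approx hcount h hK hyp) hno
  push Not at happrox
  obtain ⟨N, hN⟩ := happrox
  set E' := E ∪ (Finset.Icc 0 K ×ˢ Finset.Icc (-(N : ℤ)) N).image
    fun it => it.1 • v + it.2 • w with hE'
  have hnoz : ¬ ∃ z, Level0 X z ∧ ∀ e ∈ E', ∀ t : ℤ, z (e + t • K • v) = y e := by
    rintro ⟨z, hz, hzy⟩
    obtain ⟨u, hu, hne⟩ := hN z hz.1 (hz.fullPer hX hcount)
    apply hne
    rw [abs_le] at hu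
    obtain ⟨a, b, ha, haK, hab⟩ := h.exists_decomp_mod hK u
    have hmem : a • v + rowHom v u • w ∈ E' :=
      Finset.mem_union_right _ (Finset.mem_image.2 ⟨(a, rowHom v u), by
        simp only [Finset.mem_product, Finset.mem_Icc]
        omega, rfl⟩)
    have h1 := hzy _ hmem b
    have h2 := (hyp.zsmul b) (a • v + rowHom v u • w)
    rw [← hab] at h1 h2
    rw [h1, h2]
  obtain ⟨m₁, hm₁⟩ := (hc.extend_or_level0 hX hcount y (K • v) E').resolve_right hnoz
  obtain ⟨m₂, hm₂⟩ := (hc.extend_or_level0 hX hcount y (-(K • v)) E').resolve_right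
    fun ⟨z, hz, hzy⟩ => hnoz ⟨z, hz, fun e he t => by simpa using hzy e he (-t)⟩
  refine ⟨m₁ + m₂, fun i hi => ?_⟩
  obtain ⟨u, hu⟩ := preceq_iff.1 (hy i)
    ((E' ×ˢ Finset.Icc (-(m₂ : ℤ)) m₁).image fun et => et.1 + et.2 • K • v)
  have hu' : ∀ e ∈ E', ∀ t : ℤ, -(m₂ : ℤ) ≤ t → t ≤ m₁ → c i (e + t • K • v + u) = y e := by
    intro e he t h1 h2
    rw [hu _ (Finset.mem_image.2 ⟨(e, t), by simp [he, h1, h2], rfl⟩)]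
    exact (hyp.zsmul t) e
  have hpos := hm₁ i (by omega) u fun t ht e he => hu' e he t (by omega) (by omega)
  have hneg := hm₂ i (by omega) u fun t ht e he => by
    simpa using hu' e he (-t) (by omega) (by omega)
  refine ⟨u, fun t e he => ?_⟩
  obtain ⟨n, rfl | rfl⟩ := t.eq_nat_or_neg
  · exact hpos n e (Finset.mem_union_left _ he)
  · simpa using hneg n e (Finset.mem_union_left _ he)

theorem rowHom_smul_eq (p q u : ℤ × ℤ) :
    rowHom p q • u = rowHom u q • p + rowHom p u • q := by
  ext <;> simp [rowHom] <;> ring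

/-- The periods of two lower bounds that are not minimal are parallel. -/
theorem LowChain.rowHom_eq_zero [Finite α] {X : Set (Config α)} {D : Finset (ℤ × ℤ)}
    (hX : IsLocal X D) (hcount : X.Countable) {c : ℕ → Config α} (hc : LowChain X c)
    {y y' : Config α} (hy : ∀ i, Preceq y (c i)) (hy' : ∀ i, Preceq y' (c i)) {p p' : ℤ × ℤ}
    (hp : p ≠ 0) (hp' : p' ≠ 0) (hyp : Per p y) (hyp' : Per p' y') (hnot : ¬ FullPer y)
    (hnot' : ¬ FullPer y') : rowHom p p' = 0 := by
  classical
  by_contra hd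
  set d := rowHom p p' with hdef
  suffices hper : Per p' y by
    refine hnot fun v => ⟨d * d, mul_self_pos.2 hd, ?_⟩
    rw [mul_smul]
    refine Per.zsmul ?_ d
    rw [hdef, rowHom_smul_eq]
    exact (hyp.zsmul _).add (hper.zsmul _)
  intro q
  obtain ⟨i₁, h₁⟩ := hc.exists_strip hX hcount hy hp hyp hnot {q, q + p'}
  obtain ⟨i₂, h₂⟩ := hc.exists_strip hX hcount hy' hp' hyp' hnot'
    (Finset.Icc 0 |d| ×ˢ Finset.Icc 0 |d|)
  obtain ⟨u₁, hu₁⟩ := h₁ (i₁ + i₂) (by omega)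
  obtain ⟨u₂, hu₂⟩ := h₂ (i₁ + i₂) (by omega)
  set g := q + u₁ - u₂ with hg
  set e : ℤ × ℤ := (g.1 % d, g.2 % d) with he
  set g' : ℤ × ℤ := (g.1 / d, g.2 / d) with hg'
  have heg : g = e + (rowHom g' p' • p + rowHom p g' • p') := by
    rw [← rowHom_smul_eq, ← hdef]
    ext
    · simp [he, hg', Int.emod_add_mul_ediv]
    · simp [he, hg', Int.emod_add_mul_ediv]
  have hmem : e ∈ Finset.Icc 0 |d| ×ˢ Finset.Icc 0 |d| := by
    simp only [he, Finset.mem_product, Finset.mem_Icc]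
    exact ⟨⟨Int.emod_nonneg _ hd, (Int.emod_lt_abs _ hd).le⟩,
      ⟨Int.emod_nonneg _ hd, (Int.emod_lt_abs _ hd).le⟩⟩
  have hq : q + u₁ = e + (rowHom g' p' • p + rowHom p g' • p') + u₂ := by
    rw [← heg, hg, sub_add_cancel]
  rw [← hu₁ (-rowHom g' p') q (by simp), ← hu₁ (-rowHom g' p') (q + p') (by simp)]
  have h1 := hu₂ (rowHom p g') e hmem
  have h2 := hu₂ (rowHom p g' + 1) e hmem
  have e1 : q + -rowHom g' p' • p + u₁ = e + rowHom p g' • p' + u₂ := by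
    rw [add_right_comm, hq]
    module
  have e2 : q + p' + -rowHom g' p' • p + u₁ = e + (rowHom p g' + 1) • p' + u₂ := by
    rw [add_smul, one_smul, ← add_assoc e, add_right_comm _ p' u₂, ← e1]
    abel
  rw [e1, e2, h1, h2]

/-- All lower bounds of the chain are periodic in a common direction. -/
theorem LowChain.exists_direction [Finite α] {X : Set (Config α)} {D : Finset (ℤ × ℤ)}
    (hX : IsLocal X D) (hcount : X.Countable) {c : ℕ → Config α} (hc : LowChain X c) :
    ∃ v : ℤ × ℤ, v ≠ 0 ∧ ∀ y, (∀ i, Preceq y (c i)) → ∃ k : ℤ, 0 < k ∧ Per (k • v) y := by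
  by_cases hall : ∀ y, (∀ i, Preceq y (c i)) → FullPer y
  · exact ⟨(1, 0), by simp [Prod.ext_iff], fun y hy => hall y hy _⟩
  push Not at hall
  obtain ⟨y, hy, hnot⟩ := hall
  obtain ⟨p, hp, hyp⟩ := hX.exists_per hcount (hc.low y hy)
  refine ⟨p, hp, fun y' hy' => ?_⟩
  by_cases hnot' : FullPer y'
  · exact hnot' p
  obtain ⟨p', hp', hyp'⟩ := hX.exists_per hcount (hc.low y' hy')
  have hpar := hc.rowHom_eq_zero hX hcount hy hy' hp hp' hyp hyp' hnot hnot'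
  obtain ⟨k, l, hk, hkl⟩ : ∃ k l : ℤ, k ≠ 0 ∧ k • p = l • p' := by
    simp only [rowHom, AddMonoidHom.coe_mk, ZeroHom.coe_mk] at hpar
    by_cases h1 : p'.1 = 0
    · refine ⟨p'.2, p.2, fun h2 => hp' (Prod.ext h1 h2), ?_⟩
      ext <;> simp <;> linarith
    · refine ⟨p'.1, p.1, h1, ?_⟩
      ext <;> simp <;> linarith
  refine ⟨k * k, mul_self_pos.2 hk, ?_⟩
  rw [mul_smul, hkl]
  exact (hyp'.zsmul l).zsmul k

/-- Late terms of the chain have a nonzero period. -/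
theorem LowChain.exists_per [Finite α] {X : Set (Config α)} {D : Finset (ℤ × ℤ)}
    (hX : IsLocal X D) (hcount : X.Countable) {c : ℕ → Config α} (hc : LowChain X c) :
    ∃ (p : ℤ × ℤ) (n : ℕ), p ≠ 0 ∧ Per p (c n) := by
  obtain ⟨v, hv, hper⟩ := hc.exists_direction hX hcount
  obtain ⟨K, n, hK, h⟩ := exists_uniform_period (α := α) v
    (fun n => {y | ∃ i u, n ≤ i ∧ y = shift u (c i)})
    (fun m n hmn y ⟨i, u, hi, hy⟩ => ⟨i, u, hmn.trans hi, hy⟩)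
    (fun y w hy hw => by
      choose i u hi hyu using hy
      obtain rfl : y = fun n => shift (u n) (c (i n)) := funext hyu
      exact hper w (hc.clus_preceq hi hw))
  refine ⟨(K : ℤ) • v, n, smul_ne_zero (by omega) hv, fun u => ?_⟩
  have := h (shift u (c n)) fun t => ⟨n, (t : ℤ) • v + u, le_rfl, shift_shift _ _ _⟩
  simpa [shift, add_comm] using this

end Helpers

theorem stmt14 {A : Type*} [Fintype A] [Nonempty A] [TopologicalSpace A] [DiscreteTopology A]
    (X : Set (Config A)) (hX : IsSFT X) (hcount : X.Countable)
    (c : ℕ → Config A) (hc : ∀ i, c i ∈ X)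
    (hchain : ∀ i, Prec (c (i + 1)) (c i)) :
    ∃ x ∈ X, (∀ i, Preceq x (c i)) ∧ ¬ Level0 X x ∧ ¬ Level1 X x := by
  obtain ⟨D, hXD⟩ := hX.exists_isLocal
  by_contra! hno
  have hlow : LowChain X c :=
    { anti := fun i j hij => by
        induction j, hij using Nat.le_induction with
        | base => exact preceq_refl _
        | succ j _ ih => exact (hchain j).1.trans ih
      low := fun y hy => by
        by_contra! h
        exact h.2 (hno y (hXD.mem_of_preceq (hc 0) (hy 0)) hy h.1) }
  obtain ⟨p, n, hp, hpn⟩ := hlow.exists_per hXD hcount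
  have h0 := hXD.level0_of_prec hcount hp (hc n) hpn (hchain n)
  exact (hchain (n + 1)).2 (h0.2 _ (hc _) (hchain (n + 1)).1)

end CountableSubshift
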